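/- arXiv:1803.10832 — 2 statements merged into one kernel-verified Lean document; each statement's English description precedes it below -/
import Mathlib

section
/- Let α ∈ (0,1) and let f : [0,1) → ℝ be Lipschitz on every compact subinterval of [0,1), belong to the class L¹_{1−α}((0,1)), and satisfy f(0) = 0. Then lim_{N→∞} N^α Σ_{l=0}^{N} φ̂_α(−l) · X_{N,l} = 0, i.e. the derivative D_α(f)(0) exists and equals 0. -/
open MeasureTheory Filter Asymptotics

/-- The `n`-th Fourier coefficient of `φ_α(θ) = (1-e^{iθ})^α (1+e^{-iθ})^α`
(principal branch complex powers). -/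
noncomputable def phiHat (α : ℝ) (n : ℤ) : ℂ :=
  (1 / (2 * (Real.pi : ℂ))) * ∫ θ in (-Real.pi)..Real.pi,
    (1 - Complex.exp ((θ : ℂ) * Complex.I)) ^ (α : ℂ) *
      (1 + Complex.exp (-(θ : ℂ) * Complex.I)) ^ (α : ℂ) *
      Complex.exp (-(n : ℂ) * (θ : ℂ) * Complex.I)

/-- The discretization vector `X_{N,l}`: `f(l/N)` for `0 < l < N`, and `0` at the endpoints. -/
noncomputable def Xvec (f : ℝ → ℝ) (N l : ℕ) : ℝ :=
  if l = 0 ∨ l = N then 0 else f ((l : ℝ) / (N : ℝ))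

/-- `f` belongs to the class `L¹_{1-α}((0,1))`. -/
def MemL1Class (α : ℝ) (f : ℝ → ℝ) : Prop :=
  ∃ γ : ℝ, 0 ≤ γ ∧ γ ≤ 1 - α ∧
    (f =O[nhdsWithin 0 (Set.Ioi 0)] fun t : ℝ => t ^ (-γ)) ∧
    ((fun t : ℝ => f (1 - t)) =O[nhdsWithin 0 (Set.Ioi 0)] fun t : ℝ => t ^ (-γ))

theorem choose_succ_eq (α : ℝ) (k : ℕ) :
    Ring.choose α (k + 1) = Ring.choose α k * (α - k) / (k + 1) := by
  simp only [Ring.choose_eq_smul, descPochhammer_succ_right, Polynomial.smeval_mul,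
    Polynomial.smeval_sub, Polynomial.smeval_X, Polynomial.smeval_natCast, Nat.factorial_succ]
  have := Nat.factorial_ne_zero k
  push_cast
  simp
  field_simp

/-- The Taylor coefficients of `(1 - z) ^ α` at `0`. -/
noncomputable def oneSubCoeff (α : ℝ) (k : ℕ) : ℝ := (-1) ^ k * Ring.choose α k

theorem oneSubCoeff_succ (α : ℝ) (k : ℕ) :
    oneSubCoeff α (k + 1) = oneSubCoeff α k * (k - α) / (k + 1) := by
  rw [oneSubCoeff, oneSubCoeff, choose_succ_eq]
  ring

theorem abs_oneSubCoeff (α : ℝ) (k : ℕ) : |oneSubCoeff α k| = |Ring.choose α k| := by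
  simp [oneSubCoeff, abs_mul]

theorem abs_oneSubCoeff_sub_succ {α : ℝ} (hα : α ∈ Set.Ioo (0 : ℝ) 1) (k : ℕ) :
    |oneSubCoeff α k - oneSubCoeff α (k + 1)| = |oneSubCoeff α k| * ((1 + α) / (k + 1)) := by
  have hk : (0 : ℝ) < k + 1 := by positivity
  rw [oneSubCoeff_succ, ← abs_of_pos (div_pos (add_pos one_pos hα.1) hk), ← abs_mul]
  congr 1
  field_simp
  ring

theorem antitone_abs_oneSubCoeff {α : ℝ} (hα : α ∈ Set.Ioo (0 : ℝ) 1) :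
    Antitone fun k => |oneSubCoeff α k| := by
  refine antitone_nat_of_succ_le fun k => ?_
  have hk : (0 : ℝ) < k + 1 := by positivity
  rw [oneSubCoeff_succ, mul_div_assoc, abs_mul, abs_div, abs_of_pos hk]
  refine mul_le_of_le_one_right (abs_nonneg _) ((div_le_one hk).2 (abs_le.2 ?_))
  have := hα.1
  have := hα.2
  have := k.cast_nonneg (α := ℝ)
  constructor <;> linarith

theorem abs_oneSubCoeff_le {α : ℝ} (hα : α ∈ Set.Ioo (0 : ℝ) 1) {k : ℕ} (hk : 1 ≤ k) :
    |oneSubCoeff α k| ≤ (k : ℝ) ^ (-(1 + α)) := by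
  have h0 := hα.1
  have h1 := hα.2
  induction k, hk using Nat.le_induction with
  | base => simp [oneSubCoeff, abs_of_pos h0, h1.le]
  | succ k hk ih =>
    have hk1 : (1 : ℝ) ≤ k := by exact_mod_cast hk
    have hk' : (0 : ℝ) < k := by linarith
    have hb := one_add_mul_self_le_rpow_one_add (s := -(1 / ((k : ℝ) + 1)))
      (by rw [neg_le_neg_iff, div_le_one] <;> linarith) (p := 1 + α) (by linarith)
    rw [show 1 + -(1 / ((k : ℝ) + 1)) = k / (k + 1) by field_simp; ring,
      show 1 + (1 + α) * -(1 / ((k : ℝ) + 1)) = (k - α) / (k + 1) by field_simp; ring,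
      Real.div_rpow hk'.le (by linarith)] at hb
    have hnn : 0 ≤ ((k : ℝ) - α) / (k + 1) := div_nonneg (by linarith) (by linarith)
    rw [oneSubCoeff_succ, mul_div_assoc, abs_mul, abs_of_nonneg hnn]
    calc _ ≤ (k : ℝ) ^ (-(1 + α)) * ((k : ℝ) ^ (1 + α) / ((k : ℝ) + 1) ^ (1 + α)) := by gcongr
      _ = _ := by
        push_cast
        rw [Real.rpow_neg hk'.le, Real.rpow_neg (by linarith)]
        have := Real.rpow_pos_of_pos hk' (1 + α)
        field_simp

theorem summable_abs_choose {α : ℝ} (hα : α ∈ Set.Ioo (0 : ℝ) 1) :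
    Summable fun k => |Ring.choose α k| := by
  simp_rw [← abs_oneSubCoeff]
  rw [← summable_nat_add_iff 1]
  refine Summable.of_nonneg_of_le (fun _ => abs_nonneg _)
    (fun k => abs_oneSubCoeff_le hα (Nat.succ_pos k))
    ((summable_nat_add_iff 1).2 (Real.summable_nat_rpow.2 ?_))
  linarith [hα.1]

theorem continuousOn_one_add_cpow {α : ℝ} (hα : 0 < α) :
    ContinuousOn (fun z : ℂ => (1 + z) ^ (α : ℂ)) (Metric.closedBall 0 1) := by
  intro z hz
  refine ContinuousAt.continuousWithinAt ?_
  have hre : 0 ≤ (1 + z).re := by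
    have := (abs_le.1 (Complex.abs_re_le_norm z)).1
    rw [mem_closedBall_zero_iff] at hz
    simp
    linarith
  exact (Complex.continuousAt_cpow_of_re_pos (p := (1 + z, (α : ℂ))) (Or.inl hre)
    (by simpa using hα)).comp (f := fun z : ℂ => (1 + z, (α : ℂ))) (by fun_prop)

theorem hasSum_one_add_cpow {α : ℝ} (hα : α ∈ Set.Ioo (0 : ℝ) 1) {z : ℂ} (hz : ‖z‖ ≤ 1) :
    HasSum (fun k => ((Ring.choose α k : ℝ) : ℂ) * z ^ k) ((1 + z) ^ (α : ℂ)) := by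
  have hbound : ∀ k : ℕ, ∀ z ∈ Metric.closedBall (0 : ℂ) 1,
      ‖((Ring.choose α k : ℝ) : ℂ) * z ^ k‖ ≤ |Ring.choose α k| := by
    intro k z hz
    rw [mem_closedBall_zero_iff] at hz
    rw [norm_mul, norm_pow, Complex.norm_real, Real.norm_eq_abs]
    exact mul_le_of_le_one_right (abs_nonneg _) (pow_le_one₀ (norm_nonneg _) hz)
  have hcont := continuousOn_tsum (f := fun (k : ℕ) (z : ℂ) => ((Ring.choose α k : ℝ) : ℂ) * z ^ k)
    (s := Metric.closedBall 0 1) (fun k => by fun_prop) (summable_abs_choose hα) hbound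
  have heq : Set.EqOn (fun z : ℂ => ∑' k, ((Ring.choose α k : ℝ) : ℂ) * z ^ k)
      (fun z => (1 + z) ^ (α : ℂ)) (Metric.ball 0 1) := by
    intro z hz
    have := (Complex.one_add_cpow_hasFPowerSeriesOnBall_zero (a := α)).hasSum (y := z)
      (by rw [← ENNReal.ofReal_one, Metric.eball_ofReal]; exact hz)
    simpa [binomialSeries, Complex.ofReal_choose, smul_eq_mul, mul_comm] using this.tsum_eq
  have hmem : z ∈ Metric.closedBall (0 : ℂ) 1 := by simpa using hz
  have := heq.of_subset_closure hcont (continuousOn_one_add_cpow hα.1) Metric.ball_subset_closedBall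
    (closure_ball (0 : ℂ) one_ne_zero).ge hmem
  beta_reduce at this
  rw [← this]
  exact (Summable.of_norm_bounded (summable_abs_choose hα) fun k => hbound k z hmem).hasSum

theorem hasSum_intervalIntegral_mul {c : ℕ → ℂ} (hc : Summable fun k => ‖c k‖)
    {e : ℕ → ℝ → ℂ} (he : ∀ k, Continuous (e k)) (he1 : ∀ k θ, ‖e k θ‖ ≤ 1)
    {F G : ℝ → ℂ} (hG : Continuous G) (hF : ∀ θ, HasSum (fun k => c k * e k θ) (F θ)) (a b : ℝ) :
    HasSum (fun k => c k * ∫ θ in a..b, e k θ * G θ) (∫ θ in a..b, F θ * G θ) := by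
  simp_rw [← intervalIntegral.integral_const_mul, ← mul_assoc]
  refine intervalIntegral.hasSum_integral_of_dominated_convergence (fun k θ => ‖c k‖ * ‖G θ‖)
    (fun k => ?_) (fun k => ?_) ?_ ?_ ?_
  · exact Continuous.aestronglyMeasurable (by have := he k; fun_prop)
  · refine ae_of_all _ fun θ _ => ?_
    rw [norm_mul, norm_mul]
    gcongr
    exact mul_le_of_le_one_right (norm_nonneg _) (he1 k θ)
  · exact ae_of_all _ fun θ _ => hc.mul_right _
  · simp_rw [tsum_mul_right]
    exact Continuous.intervalIntegrable (by fun_prop) _ _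
  · exact ae_of_all _ fun θ _ => (hF θ).mul_right _

theorem integral_cexp_int_mul (n : ℤ) :
    ∫ θ in (-Real.pi)..Real.pi, Complex.exp ((n : ℂ) * θ * Complex.I) =
      if n = 0 then 2 * (Real.pi : ℂ) else 0 := by
  split_ifs with h
  · simp [h]; ring
  · have hc : (n : ℂ) * Complex.I ≠ 0 := by simp [h]
    have : ∀ θ : ℝ, Complex.exp ((n : ℂ) * θ * Complex.I) =
        Complex.exp ((n : ℂ) * Complex.I * θ) := fun θ => by ring_nf
    simp_rw [this]
    rw [integral_exp_mul_complex hc, div_eq_zero_iff, sub_eq_zero]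
    left
    rw [Complex.exp_eq_exp_iff_exists_int]
    exact ⟨n, by push_cast; ring⟩

theorem hasSum_phiHat_neg {α : ℝ} (hα : α ∈ Set.Ioo (0 : ℝ) 1) (l : ℕ) :
    HasSum (fun j => (((-1) ^ l * (Ring.choose α j * oneSubCoeff α (j + l)) : ℝ) : ℂ))
      (phiHat α (-(l : ℤ))) := by
  have hexp : ∀ θ : ℝ, ‖Complex.exp (-(θ : ℂ) * Complex.I)‖ = 1 := fun θ => by
    simpa using Complex.norm_exp_ofReal_mul_I (-θ)
  have hsum : Summable fun k => ‖((Ring.choose α k : ℝ) : ℂ)‖ := by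
    simpa only [Complex.norm_real, Real.norm_eq_abs] using summable_abs_choose hα
  have inner (m : ℕ) : ∫ θ in (-Real.pi)..Real.pi,
      (1 + Complex.exp (-(θ : ℂ) * Complex.I)) ^ (α : ℂ) *
        Complex.exp ((m : ℂ) * θ * Complex.I) = 2 * Real.pi * (Ring.choose α m : ℝ) := by
    have h := hasSum_intervalIntegral_mul hsum
      (e := fun k θ => Complex.exp (-(θ : ℂ) * Complex.I) ^ k) (fun k => by fun_prop)
      (fun k θ => by rw [norm_pow, hexp, one_pow]) (G := fun θ : ℝ => Complex.exp ((m : ℂ) * θ * Complex.I))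
      (by fun_prop) (fun θ => hasSum_one_add_cpow hα (hexp θ).le) (-Real.pi) Real.pi
    refine h.unique ?_
    convert hasSum_ite_eq m (2 * (Real.pi : ℂ) * (Ring.choose α m : ℝ)) using 2 with k
    have : ∀ θ : ℝ, Complex.exp (-(θ : ℂ) * Complex.I) ^ k * Complex.exp ((m : ℂ) * θ * Complex.I)
        = Complex.exp ((((m : ℤ) - (k : ℤ) : ℤ) : ℂ) * θ * Complex.I) := fun θ => by
      rw [← Complex.exp_nat_mul, ← Complex.exp_add]
      push_cast
      ring_nf
    simp_rw [this]
    rw [integral_cexp_int_mul]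
    by_cases hkm : k = m
    · simp [hkm, mul_comm]
    · rw [if_neg (by omega), if_neg hkm, mul_zero]
  have hG : Continuous fun θ : ℝ => (1 + Complex.exp (-(θ : ℂ) * Complex.I)) ^ (α : ℂ) *
      Complex.exp ((l : ℂ) * θ * Complex.I) :=
    ((continuousOn_one_add_cpow hα.1).comp_continuous
      (f := fun θ : ℝ => Complex.exp (-(θ : ℂ) * Complex.I)) (by fun_prop)
      (fun θ => by rw [mem_closedBall_zero_iff, hexp])).mul (by fun_prop)
  have h := (hasSum_intervalIntegral_mul hsum
    (e := fun k θ => (-Complex.exp ((θ : ℂ) * Complex.I)) ^ k) (fun k => by fun_prop)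
    (fun k θ => by simp [Complex.norm_exp_ofReal_mul_I]) hG
    (fun θ => hasSum_one_add_cpow hα (z := -Complex.exp ((θ : ℂ) * Complex.I))
      (by simp [Complex.norm_exp_ofReal_mul_I])) (-Real.pi) Real.pi).mul_left
    (1 / (2 * (Real.pi : ℂ)))
  have hval : phiHat α (-(l : ℤ)) = 1 / (2 * (Real.pi : ℂ)) * ∫ θ in (-Real.pi)..Real.pi,
      (1 + -Complex.exp ((θ : ℂ) * Complex.I)) ^ (α : ℂ) *
        ((1 + Complex.exp (-(θ : ℂ) * Complex.I)) ^ (α : ℂ) *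
          Complex.exp ((l : ℂ) * θ * Complex.I)) := by
    unfold phiHat
    congr 1
    refine intervalIntegral.integral_congr fun θ _ => ?_
    simp [sub_eq_add_neg, mul_assoc]
  rw [hval]
  refine h.congr_fun fun j => ?_
  have : ∀ θ : ℝ, (-Complex.exp ((θ : ℂ) * Complex.I)) ^ j *
      ((1 + Complex.exp (-(θ : ℂ) * Complex.I)) ^ (α : ℂ) * Complex.exp ((l : ℂ) * θ * Complex.I))
      = (-1) ^ j * ((1 + Complex.exp (-(θ : ℂ) * Complex.I)) ^ (α : ℂ) *
        Complex.exp (((j + l : ℕ) : ℂ) * θ * Complex.I)) := fun θ => by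
    have he : Complex.exp (((j + l : ℕ) : ℂ) * θ * Complex.I) =
        Complex.exp ((θ : ℂ) * Complex.I) ^ j * Complex.exp ((l : ℂ) * θ * Complex.I) := by
      rw [← Complex.exp_nat_mul, ← Complex.exp_add]
      push_cast
      ring_nf
    rw [he, neg_pow]
    ring
  simp_rw [this]
  rw [intervalIntegral.integral_const_mul, inner]
  have hpi : (Real.pi : ℂ) ≠ 0 := by exact_mod_cast Real.pi_ne_zero
  have hl : ((-1 : ℂ) ^ l) ^ 2 = 1 := by rw [← pow_mul, pow_mul', neg_one_sq, one_pow]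
  rw [oneSubCoeff]
  push_cast
  field_simp
  rw [pow_add]
  linear_combination Ring.choose (α : ℂ) j * Ring.choose (α : ℂ) (j + l) * (-1) ^ j * hl

/-- The signed coefficient `(-1) ^ l * φ̂_α(-l)`, see `phiHat_neg`. -/
noncomputable def phiAmp (α : ℝ) (l : ℕ) : ℝ := ∑' j, Ring.choose α j * oneSubCoeff α (j + l)

theorem phiHat_neg {α : ℝ} (hα : α ∈ Set.Ioo (0 : ℝ) 1) (l : ℕ) :
    phiHat α (-(l : ℤ)) = (((-1) ^ l * phiAmp α l : ℝ) : ℂ) := by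
  rw [← (hasSum_phiHat_neg hα l).tsum_eq, ← Complex.ofReal_tsum, tsum_mul_left, phiAmp]

theorem summable_choose_mul {α : ℝ} (hα : α ∈ Set.Ioo (0 : ℝ) 1) (l : ℕ) :
    Summable fun j => Ring.choose α j * oneSubCoeff α (j + l) := by
  refine Summable.of_norm_bounded ((summable_abs_choose hα).mul_right |oneSubCoeff α l|)
    fun j => ?_
  rw [norm_mul, Real.norm_eq_abs, Real.norm_eq_abs]
  exact mul_le_mul_of_nonneg_left (antitone_abs_oneSubCoeff hα (Nat.le_add_left l j))
    (abs_nonneg _)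

theorem abs_phiAmp_le {α : ℝ} (hα : α ∈ Set.Ioo (0 : ℝ) 1) (l : ℕ) :
    |phiAmp α l| ≤ (∑' j, |Ring.choose α j|) * |oneSubCoeff α l| := by
  rw [phiAmp, ← Real.norm_eq_abs]
  refine tsum_of_norm_bounded ((summable_abs_choose hα).hasSum.mul_right _) fun j => ?_
  rw [norm_mul, Real.norm_eq_abs, Real.norm_eq_abs]
  exact mul_le_mul_of_nonneg_left (antitone_abs_oneSubCoeff hα (Nat.le_add_left l j))
    (abs_nonneg _)

theorem abs_phiAmp_sub_succ_le {α : ℝ} (hα : α ∈ Set.Ioo (0 : ℝ) 1) (l : ℕ) :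
    |phiAmp α l - phiAmp α (l + 1)| ≤
      (∑' j, |Ring.choose α j|) * (|oneSubCoeff α l| * ((1 + α) / (l + 1))) := by
  rw [phiAmp, phiAmp, ← (summable_choose_mul hα l).tsum_sub (summable_choose_mul hα (l + 1))]
  rw [← Real.norm_eq_abs]
  refine tsum_of_norm_bounded ((summable_abs_choose hα).hasSum.mul_right _) fun j => ?_
  rw [← mul_sub, norm_mul, Real.norm_eq_abs, Real.norm_eq_abs, ← add_assoc,
    abs_oneSubCoeff_sub_succ hα]
  have := hα.1
  refine mul_le_mul_of_nonneg_left (mul_le_mul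
    (antitone_abs_oneSubCoeff hα (Nat.le_add_left l j)) ?_ (by positivity) (abs_nonneg _))
    (abs_nonneg _)
  gcongr
  exact Nat.le_add_left l j

theorem two_mul_sum_range_alternating (u : ℕ → ℝ) (n : ℕ) :
    2 * ∑ l ∈ Finset.range n, (-1) ^ l * u l =
      u 0 - (-1) ^ n * u n + ∑ l ∈ Finset.range n, (-1) ^ l * (u l - u (l + 1)) := by
  induction n with
  | zero => simp
  | succ n ih =>
    rw [Finset.sum_range_succ, Finset.sum_range_succ, mul_add, ih, pow_succ]
    ring

/-- Summation by parts for alternating sums of a slowly varying summable weight against a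
Lipschitz sequence vanishing at `0`. -/
theorem abs_sum_range_alternating_le {g w x : ℕ → ℝ} (hw : Summable w) (hanti : Antitone w)
    (hg : ∀ l, |g l| ≤ w l) (hg' : ∀ l : ℕ, |g l - g (l + 1)| * (l + 1) ≤ w l)
    {L : ℝ} {n : ℕ} (hx : ∀ l ≤ n, |x l| ≤ L * l) (hx' : ∀ l < n, |x l - x (l + 1)| ≤ L)
    (hL : 0 ≤ L) :
    |∑ l ∈ Finset.range n, (-1) ^ l * (g l * x l)| ≤ 2 * L * ∑' l, w l := by
  have hw0 : ∀ l, 0 ≤ w l := fun l => (abs_nonneg _).trans (hg l)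
  have hpart : ∑ l ∈ Finset.range n, w l ≤ ∑' l, w l := hw.sum_le_tsum _ fun l _ => hw0 l
  have hxzero : x 0 = 0 := by simpa using hx 0 n.zero_le
  have hend : |g n * x n| ≤ L * ∑' l, w l := by
    have : (n : ℝ) * w n ≤ ∑ l ∈ Finset.range n, w l := by
      simpa using Finset.card_nsmul_le_sum (Finset.range n) w (w n)
        fun l hl => hanti (Finset.mem_range.1 hl).le
    calc |g n * x n| ≤ w n * (L * n) := by
          rw [abs_mul]; gcongr; exacts [hw0 n, hg n, hx n le_rfl]
      _ = L * (n * w n) := by ring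
      _ ≤ _ := by gcongr; linarith
  have hdiff : ∀ l ∈ Finset.range n,
      |(-1) ^ l * (g l * x l - g (l + 1) * x (l + 1))| ≤ 2 * L * w l := by
    intro l hl
    have hl := Finset.mem_range.1 hl
    rw [abs_mul, abs_neg_one_pow, one_mul,
      show g l * x l - g (l + 1) * x (l + 1) =
        (g l - g (l + 1)) * x l + g (l + 1) * (x l - x (l + 1)) by ring]
    have h1 : |(g l - g (l + 1)) * x l| ≤ L * w l := by
      rw [abs_mul]
      calc _ ≤ |g l - g (l + 1)| * (L * (l + 1)) := by
            gcongr
            exact (hx l hl.le).trans (by gcongr; linarith)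
        _ = L * (|g l - g (l + 1)| * (l + 1)) := by ring
        _ ≤ _ := by gcongr; exact hg' l
    have h2 : |g (l + 1) * (x l - x (l + 1))| ≤ L * w l := by
      rw [abs_mul, mul_comm]
      gcongr
      exacts [hx' l hl, (hg _).trans (hanti l.le_succ)]
    exact (abs_add_le _ _).trans (by linarith)
  have h := two_mul_sum_range_alternating (fun l => g l * x l) n
  have hS : |∑ l ∈ Finset.range n, (-1) ^ l * (g l * x l - g (l + 1) * x (l + 1))| ≤
      2 * L * ∑' l, w l := by
    refine (Finset.abs_sum_le_sum_abs _ _).trans ((Finset.sum_le_sum hdiff).trans ?_)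
    rw [← Finset.mul_sum]
    gcongr
  have hend' : |(-1) ^ n * (g n * x n)| ≤ L * ∑' l, w l := by
    rwa [abs_mul, abs_neg_one_pow, one_mul]
  have hLW : 0 ≤ L * ∑' l, w l := mul_nonneg hL (tsum_nonneg hw0)
  simp only [hxzero, mul_zero, zero_sub] at h
  rw [abs_le] at *
  constructor <;> linarith

theorem sum_range_rpow_neg_le {γ : ℝ} (h0 : 0 ≤ γ) (h1 : γ < 1) (k : ℕ) :
    ∑ m ∈ Finset.range k, ((m : ℝ) + 1) ^ (-γ) ≤ (k : ℝ) ^ (1 - γ) / (1 - γ) := by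
  have hs : 0 < 1 - γ := by linarith
  induction k with
  | zero => simp [Real.zero_rpow hs.ne']
  | succ k ih =>
    have hk : (0 : ℝ) < k + 1 := by positivity
    have hb := rpow_one_add_le_one_add_mul_self (s := -(1 / ((k : ℝ) + 1)))
      (by rw [neg_le_neg_iff, div_le_one hk]; linarith [k.cast_nonneg (α := ℝ)]) hs.le
      (by linarith)
    rw [show 1 + -(1 / ((k : ℝ) + 1)) = k / (k + 1) by field_simp; ring,
      Real.div_rpow k.cast_nonneg hk.le, div_le_iff₀ (by positivity)] at hb
    rw [Finset.sum_range_succ]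
    have he : ((k : ℝ) + 1) ^ (-γ) = (k + 1) ^ (1 - γ) / (k + 1) := by
      rw [← Real.rpow_sub_one hk.ne']
      congr 1
      ring
    rw [le_div_iff₀ hs] at ih ⊢
    rw [add_mul, he]
    push_cast
    have : (1 + (1 - γ) * -(1 / ((k : ℝ) + 1))) * ((k : ℝ) + 1) ^ (1 - γ) =
      ((k : ℝ) + 1) ^ (1 - γ) - ((k : ℝ) + 1) ^ (1 - γ) / (k + 1) * (1 - γ) := by ring
    linarith

theorem sum_Ico_one_sub_div_rpow_neg_le {γ : ℝ} (h0 : 0 ≤ γ) (h1 : γ < 1) {b : ℝ}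
    {n N : ℕ} (hN : 0 < N) (hnN : n ≤ N) (hbn : b * N ≤ n) :
    ∑ l ∈ Finset.Ico n N, (1 - (l : ℝ) / N) ^ (-γ) ≤ N * ((1 - b) ^ (1 - γ) / (1 - γ)) := by
  have hN' : (0 : ℝ) < N := by exact_mod_cast hN
  have hb : 0 ≤ 1 - b := by
    have : (n : ℝ) ≤ N := by exact_mod_cast hnN
    nlinarith
  rw [Finset.sum_Ico_eq_sum_range, ← Finset.sum_range_reflect]
  calc _ = ∑ m ∈ Finset.range (N - n), (N : ℝ) ^ γ * ((m : ℝ) + 1) ^ (-γ) := by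
        refine Finset.sum_congr rfl fun m hm => ?_
        have hm := Finset.mem_range.1 hm
        have hc : ((n + (N - n - 1 - m) : ℕ) : ℝ) = N - (m + 1) := by
          rw [eq_sub_iff_add_eq]
          exact_mod_cast (by omega : n + (N - n - 1 - m) + (m + 1) = N)
        rw [hc, show 1 - ((N : ℝ) - (m + 1)) / N = (m + 1) / N by field_simp; ring,
          Real.div_rpow (by positivity) hN'.le, Real.rpow_neg hN'.le γ, div_inv_eq_mul, mul_comm]
    _ ≤ (N : ℝ) ^ γ * (((N - n : ℕ) : ℝ) ^ (1 - γ) / (1 - γ)) := by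
        rw [← Finset.mul_sum]
        gcongr
        exact sum_range_rpow_neg_le h0 h1 _
    _ ≤ (N : ℝ) ^ γ * ((N * (1 - b)) ^ (1 - γ) / (1 - γ)) := by
        have : ((N - n : ℕ) : ℝ) ≤ N * (1 - b) := by
          rw [Nat.cast_sub hnN]; linarith
        have : 0 ≤ 1 - γ := by linarith
        gcongr
    _ = _ := by
        rw [Real.mul_rpow hN'.le hb, mul_div_assoc, ← mul_assoc, ← Real.rpow_add hN']
        simp

theorem tendsto_rpow_mul_alternating_sum {α : ℝ} (hα : α ∈ Set.Ioo (0 : ℝ) 1) {g w : ℕ → ℝ}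
    (hw : Summable w) (hanti : Antitone w) (hg : ∀ l, |g l| ≤ w l)
    (hg' : ∀ l : ℕ, |g l - g (l + 1)| * (l + 1) ≤ w l)
    {C : ℝ} (hC : ∀ l : ℕ, 1 ≤ l → w l ≤ C * (l : ℝ) ^ (-(1 + α)))
    {f : ℝ → ℝ} (hlip : ∀ b : ℝ, 0 ≤ b → b < 1 → ∃ K : ℝ, ∀ z ∈ Set.Icc (0 : ℝ) b,
      ∀ z' ∈ Set.Icc (0 : ℝ) b, |f z - f z'| ≤ K * |z - z'|)
    (h0 : f 0 = 0) {γ : ℝ} (hγ0 : 0 ≤ γ) (hγ1 : γ < 1)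
    (hf : (fun t : ℝ => f (1 - t)) =O[nhdsWithin 0 (Set.Ioi 0)] fun t : ℝ => t ^ (-γ)) :
    Tendsto (fun N : ℕ => (N : ℝ) ^ α *
      ∑ l ∈ Finset.range N, (-1) ^ l * (g l * f ((l : ℝ) / N))) atTop (nhds 0) := by
  have hw0 : ∀ l, 0 ≤ w l := fun l => (abs_nonneg _).trans (hg l)
  have hC0 : 0 ≤ C := by simpa using (hw0 1).trans (hC 1 le_rfl)
  obtain ⟨M, hM0, hM⟩ := hf.exists_nonneg
  obtain ⟨δ, hδ, hM⟩ := (mem_nhdsGT_iff_exists_Ioo_subset.1 hM.bound)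
  rw [Set.mem_Ioi] at hδ
  set D : ℝ := C * 2 ^ (1 + α) * M / (1 - γ) with hD
  rw [Metric.tendsto_atTop']
  intro ε hε
  have hsmall : Tendsto (fun t : ℝ => D * t ^ (1 - γ)) (nhdsWithin 0 (Set.Ioi 0)) (nhds 0) := by
    have : ContinuousAt (fun t : ℝ => D * t ^ (1 - γ)) 0 :=
      continuousAt_const.mul (Real.continuousAt_rpow_const _ _ (Or.inr (by linarith)))
    have h := this.tendsto
    simp only [Real.zero_rpow (by linarith : 1 - γ ≠ 0), mul_zero] at h
    exact h.mono_left nhdsWithin_le_nhds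
  obtain ⟨t, ht, htδ, ht0⟩ := ((hsmall.eventually (gt_mem_nhds (half_pos hε))).and
    (Ioo_mem_nhdsGT (lt_min hδ (by norm_num : (0 : ℝ) < 1 / 2)))).exists
  have htδ' : t < δ := ht0.trans_le (min_le_left _ _)
  have ht2 : t < 1 / 2 := ht0.trans_le (min_le_right _ _)
  obtain ⟨K, hK⟩ := hlip (1 - t / 2) (by linarith) (by linarith)
  set W : ℝ := ∑' l, w l
  have hlow : Tendsto (fun N : ℕ => 2 * |K| * W * (N : ℝ) ^ (-(1 - α))) atTop (nhds 0) := by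
    simpa using ((tendsto_rpow_neg_atTop (by linarith [hα.2] : 0 < 1 - α)).comp
      tendsto_natCast_atTop_atTop).const_mul (2 * |K| * W)
  obtain ⟨N₀, hN₀⟩ := eventually_atTop.1
    ((hlow.eventually (gt_mem_nhds (half_pos hε))).and
      (tendsto_natCast_atTop_atTop.eventually_ge_atTop (2 / t)))
  refine ⟨N₀, fun N hN => ?_⟩
  obtain ⟨hN1, hN2⟩ := hN₀ N hN.le
  have hNpos : (0 : ℝ) < N := lt_of_lt_of_le (by positivity) hN2
  have hNt : 1 / (N : ℝ) ≤ t / 2 := by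
    rw [div_le_iff₀ htδ] at hN2
    rw [div_le_iff₀ hNpos]
    linarith
  set n : ℕ := ⌈(1 - t) * N⌉₊
  have hn1 : (1 - t) * N ≤ n := Nat.le_ceil _
  have hn2 : (n : ℝ) < (1 - t) * N + 1 := Nat.ceil_lt_add_one (by nlinarith)
  have hnN : n ≤ N := Nat.ceil_le.2 (by nlinarith)
  have hmem : ∀ l ≤ n, (l : ℝ) / N ∈ Set.Icc (0 : ℝ) (1 - t / 2) := by
    intro l hl
    have hl' : (l : ℝ) ≤ n := by exact_mod_cast hl
    refine ⟨by positivity, ?_⟩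
    rw [div_le_iff₀ hNpos] at hNt ⊢
    linarith
  have hlower : |∑ l ∈ Finset.range n, (-1) ^ l * (g l * f ((l : ℝ) / N))| ≤
      2 * (|K| / N) * W := by
    refine abs_sum_range_alternating_le hw hanti hg hg' (fun l hl => ?_) (fun l hl => ?_)
      (by positivity)
    · have h := hK _ (hmem l hl) _ (hmem 0 n.zero_le)
      rw [Nat.cast_zero, zero_div, h0, sub_zero, sub_zero, abs_of_nonneg (hmem l hl).1] at h
      refine h.trans ((mul_le_mul_of_nonneg_right (le_abs_self K) (hmem l hl).1).trans_eq ?_)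
      ring
    · have h := hK _ (hmem l hl.le) _ (hmem (l + 1) hl)
      rw [← sub_div, abs_div, abs_of_pos hNpos] at h
      push_cast at h ⊢
      rw [show (l : ℝ) - (l + 1) = -1 by ring, abs_neg, abs_one, mul_one_div] at h
      exact h.trans (by gcongr; exact le_abs_self K)
  have hupper : |∑ l ∈ Finset.Ico n N, (-1) ^ l * (g l * f ((l : ℝ) / N))| ≤
      (N : ℝ) ^ (-α) * (D * t ^ (1 - γ)) := by
    calc _ ≤ ∑ l ∈ Finset.Ico n N,
          (C * ((N : ℝ) / 2) ^ (-(1 + α))) * (M * (1 - (l : ℝ) / N) ^ (-γ)) := by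
          refine (Finset.abs_sum_le_sum_abs _ _).trans (Finset.sum_le_sum fun l hl => ?_)
          obtain ⟨hl1, hl2⟩ := Finset.mem_Ico.1 hl
          have hl1 : (n : ℝ) ≤ l := by exact_mod_cast hl1
          have hl2 : (l : ℝ) < N := by exact_mod_cast hl2
          have hlN : (N : ℝ) / 2 ≤ l := by nlinarith
          have hlpos : 1 ≤ l := by
            have : (0 : ℝ) < l := by linarith
            exact_mod_cast this
          have hpos : 0 < 1 - (l : ℝ) / N := by rw [sub_pos, div_lt_one hNpos]; exact hl2
          have hlt : 1 - (l : ℝ) / N ≤ t := by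
            rw [sub_le_comm, le_div_iff₀ hNpos]; linarith
          have hfl := hM ⟨hpos, hlt.trans_lt htδ'⟩
          simp only [Set.mem_ofPred_eq, sub_sub_cancel, Real.norm_eq_abs] at hfl
          rw [abs_of_pos (Real.rpow_pos_of_pos hpos _)] at hfl
          rw [abs_mul, abs_neg_one_pow, one_mul, abs_mul]
          refine mul_le_mul ((hg l).trans ((hC l hlpos).trans ?_)) hfl (abs_nonneg _)
            (by positivity)
          refine mul_le_mul_of_nonneg_left ?_ hC0
          exact Real.rpow_le_rpow_of_nonpos (by positivity) hlN (by linarith [hα.1])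
      _ ≤ (C * ((N : ℝ) / 2) ^ (-(1 + α))) * (M * (N * (t ^ (1 - γ) / (1 - γ)))) := by
          rw [← Finset.mul_sum, ← Finset.mul_sum]
          have := sum_Ico_one_sub_div_rpow_neg_le hγ0 hγ1 (by exact_mod_cast hNpos) hnN hn1
          rw [sub_sub_cancel] at this
          gcongr
      _ = _ := by
          rw [hD, Real.div_rpow hNpos.le zero_le_two, Real.rpow_neg zero_le_two, div_inv_eq_mul,
            show -α = -(1 + α) + 1 by ring, Real.rpow_add_one hNpos.ne']
          ring
  rw [dist_zero_right, Real.norm_eq_abs, abs_mul, abs_of_pos (Real.rpow_pos_of_pos hNpos α),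
    ← Finset.sum_range_add_sum_Ico _ hnN]
  calc _ ≤ (N : ℝ) ^ α * (2 * (|K| / N) * W + (N : ℝ) ^ (-α) * (D * t ^ (1 - γ))) := by
        gcongr
        exact (abs_add_le _ _).trans (add_le_add hlower hupper)
    _ = 2 * |K| * W * (N : ℝ) ^ (-(1 - α)) + D * t ^ (1 - γ) := by
        rw [mul_add, ← mul_assoc (_ ^ α) (_ ^ (-α)), ← Real.rpow_add hNpos, show -(1 - α) = α - 1 by ring,
          Real.rpow_sub_one hNpos.ne', add_neg_cancel, Real.rpow_zero]
        ring
    _ < ε := by linarith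

/-- For `α ∈ (0,1)` and `f` Lipschitz on every compact subinterval of `[0,1)`,
in `L¹_{1-α}((0,1))` and with `f(0)=0`, the derivative `D_α(f)(0)` exists and is `0`. -/
theorem fractional_derivative_at_zero (α : ℝ) (hα : α ∈ Set.Ioo (0 : ℝ) 1) (f : ℝ → ℝ)
    (hlip : ∀ b : ℝ, 0 ≤ b → b < 1 →
      ∃ K : ℝ, ∀ z ∈ Set.Icc (0 : ℝ) b, ∀ z' ∈ Set.Icc (0 : ℝ) b, |f z - f z'| ≤ K * |z - z'|)
    (hmem : MemL1Class α f) (h0 : f 0 = 0) :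
    Tendsto
      (fun N : ℕ => (((N : ℝ) ^ α : ℝ) : ℂ) *
        ∑ l ∈ Finset.range (N + 1), phiHat α (-(l : ℤ)) * ((Xvec f N l : ℝ) : ℂ))
      atTop (nhds 0) := by
  obtain ⟨γ, hγ0, hγ1, -, hf⟩ := hmem
  set S : ℝ := ∑' j, |Ring.choose α j|
  have hS : 0 ≤ S := tsum_nonneg fun _ => abs_nonneg _
  have hreal := tendsto_rpow_mul_alternating_sum hα (g := phiAmp α)
    (w := fun l => S * 2 * |oneSubCoeff α l|) (C := S * 2)
    (Summable.mul_left _ (by simpa only [abs_oneSubCoeff] using summable_abs_choose hα))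
    (fun k l hkl => mul_le_mul_of_nonneg_left (antitone_abs_oneSubCoeff hα hkl) (by positivity))
    (fun l => (abs_phiAmp_le hα l).trans (by gcongr; linarith)) (fun l => ?_)
    (fun l hl => mul_le_mul_of_nonneg_left (abs_oneSubCoeff_le hα hl) (by positivity))
    hlip h0 hγ0 (by linarith [hα.1]) hf
  · rw [← Complex.ofReal_zero]
    refine ((Complex.continuous_ofReal.tendsto 0).comp hreal).congr fun N => ?_
    rw [Function.comp_apply, Complex.ofReal_mul, Complex.ofReal_sum, Finset.sum_range_succ]
    simp only [Xvec, or_true, if_true, Complex.ofReal_zero, mul_zero, add_zero]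
    congr 1
    refine Finset.sum_congr rfl fun l hl => ?_
    rw [phiHat_neg hα, ← Complex.ofReal_mul, ← mul_assoc]
    rcases eq_or_ne l 0 with rfl | hl0
    · simp [h0]
    · rw [if_neg (by simp [hl0, (Finset.mem_range.1 hl).ne])]
  · calc _ ≤ S * (|oneSubCoeff α l| * ((1 + α) / (l + 1))) * (l + 1) := by
          gcongr
          exact abs_phiAmp_sub_succ_le hα l
      _ = S * (1 + α) * |oneSubCoeff α l| := by field_simp
      _ ≤ _ := by gcongr; linarith [hα.2]
end

section
/- Let n be a positive integer and f ∈ C^n([0,1]). Then, as N → ∞, max over integers k with n < k < N−n of | Σ_{l=0}^{N} φ̂_n(k−l) · f(l/N) − (2^n/N^n) · f^{(n)}(k/N) | = o(N^{−n}). -/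
open MeasureTheory Filter Asymptotics

lemma integral_exp_int_mul_I (p : ℤ) :
    ∫ θ in (-Real.pi)..Real.pi, Complex.exp ((p : ℂ) * (θ : ℂ) * Complex.I) =
      if p = 0 then 2 * (Real.pi : ℂ) else 0 := by
  split_ifs with h
  · subst h
    simp
    ring
  · have hp : (p : ℂ) * Complex.I ≠ 0 := by simp [h]
    have he : ∀ θ : ℝ, Complex.exp ((p : ℂ) * (θ : ℂ) * Complex.I) =
        Complex.exp ((p : ℂ) * Complex.I * (θ : ℂ)) := fun θ => by ring_nf
    simp_rw [he]
    rw [integral_exp_mul_complex hp, div_eq_zero_iff, sub_eq_zero]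
    left
    rw [Complex.exp_eq_exp_iff_exists_int]
    exact ⟨p, by push_cast; ring⟩

lemma phiHat_natCast (n : ℕ) (m : ℤ) :
    phiHat (n : ℝ) m = ∑ j ∈ Finset.range (n + 1),
      if m = (n : ℤ) - 2 * j then (-1 : ℂ) ^ (n - j) * (n.choose j : ℂ) else 0 := by
  have he : ∀ θ : ℝ, (1 - Complex.exp ((θ : ℂ) * Complex.I)) ^ (((n : ℝ) : ℝ) : ℂ) *
      (1 + Complex.exp (-(θ : ℂ) * Complex.I)) ^ (((n : ℝ) : ℝ) : ℂ) *
      Complex.exp (-(m : ℂ) * (θ : ℂ) * Complex.I) =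
      ∑ j ∈ Finset.range (n + 1), ((-1 : ℂ) ^ (n - j) * (n.choose j : ℂ)) *
        Complex.exp ((((n : ℤ) - 2 * j - m : ℤ) : ℂ) * (θ : ℂ) * Complex.I) := by
    intro θ
    have hb : (1 - Complex.exp ((θ : ℂ) * Complex.I)) *
        (1 + Complex.exp (-(θ : ℂ) * Complex.I)) =
        Complex.exp (-(θ : ℂ) * Complex.I) + -Complex.exp ((θ : ℂ) * Complex.I) := by
      have : Complex.exp ((θ : ℂ) * Complex.I) * Complex.exp (-(θ : ℂ) * Complex.I) = 1 := by
        rw [← Complex.exp_add]; simp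
      linear_combination -this
    rw [Complex.ofReal_natCast, Complex.cpow_natCast, Complex.cpow_natCast, ← mul_pow, hb,
      add_pow, Finset.sum_mul]
    refine Finset.sum_congr rfl fun j hj => ?_
    have hjn : j ≤ n := Nat.lt_succ_iff.mp (Finset.mem_range.mp hj)
    rw [neg_pow (Complex.exp _), ← Complex.exp_nat_mul, ← Complex.exp_nat_mul]
    have : Complex.exp ((((n : ℤ) - 2 * j - m : ℤ) : ℂ) * (θ : ℂ) * Complex.I) =
        Complex.exp ((j : ℂ) * (-(θ : ℂ) * Complex.I)) *
        Complex.exp (((n - j : ℕ) : ℂ) * ((θ : ℂ) * Complex.I)) *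
        Complex.exp (-(m : ℂ) * (θ : ℂ) * Complex.I) := by
      rw [← Complex.exp_add, ← Complex.exp_add]
      congr 1
      push_cast [Nat.cast_sub hjn]
      ring
    rw [this]
    ring
  unfold phiHat
  simp_rw [he]
  rw [intervalIntegral.integral_finsetSum
    (fun j _ => Continuous.intervalIntegrable (by fun_prop) _ _), Finset.mul_sum]
  refine Finset.sum_congr rfl fun j _ => ?_
  rw [intervalIntegral.integral_const_mul, integral_exp_int_mul_I]
  have hpi : (Real.pi : ℂ) ≠ 0 := by exact_mod_cast Real.pi_ne_zero
  by_cases h : m = (n : ℤ) - 2 * j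
  · rw [if_pos (by omega), if_pos h]
    field_simp
  · rw [if_neg (by omega), if_neg h]
    simp

lemma sum_phiHat_mul_eq_fwdDiff_iter (n N k : ℕ) (hk : n ≤ k) (hkN : k + n ≤ N) (f : ℝ → ℝ) :
    ∑ l ∈ Finset.range (N + 1),
      phiHat (n : ℝ) ((k : ℤ) - (l : ℤ)) * ((f ((l : ℝ) / (N : ℝ)) : ℝ) : ℂ) =
      (((fwdDiff (2 / N : ℝ))^[n] f (((k : ℝ) - n) / N) : ℝ) : ℂ) := by
  simp_rw [phiHat_natCast, Finset.sum_mul]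
  rw [Finset.sum_comm, fwdDiff_iter_eq_sum_shift]
  push_cast
  refine Finset.sum_congr rfl fun j hj => ?_
  have hjn : j ≤ n := Nat.lt_succ_iff.mp (Finset.mem_range.mp hj)
  rw [Finset.sum_eq_single (k - n + 2 * j)]
  · rw [if_pos (by omega)]
    have : ((k - n + 2 * j : ℕ) : ℝ) / N = ((k : ℝ) - n) / N + j • (2 / N : ℝ) := by
      push_cast [Nat.cast_sub hk]
      rw [nsmul_eq_mul]
      ring
    rw [this]
    simp
  · intro l _ hl
    rw [if_neg (by omega), zero_mul]
  · intro h
    exact absurd (Finset.mem_range.mpr (by omega)) h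

lemma exists_fwdDiff_iter_eq_iteratedDerivWithin {a b h : ℝ} (hab : a < b) (hh : 0 < h) (n : ℕ) :
    ∀ {f : ℝ → ℝ}, ContDiffOn ℝ n f (Set.Icc a b) → ∀ {x : ℝ}, a ≤ x → x + n * h ≤ b →
      ∃ ξ ∈ Set.Icc x (x + n * h),
        (fwdDiff h)^[n] f x = h ^ n * iteratedDerivWithin n f (Set.Icc a b) ξ := by
  induction n with
  | zero =>
    intro f _ x _ _
    exact ⟨x, by simp, by simp⟩
  | succ n ih =>
    intro f hf x hax hxb
    push_cast at hxb
    have hd : DifferentiableOn ℝ f (Set.Icc a b) := hf.differentiableOn (by simp)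
    have hf' : ContDiffOn ℝ n (derivWithin f (Set.Icc a b)) (Set.Icc a b) :=
      hf.derivWithin (uniqueDiffOn_Icc hab) (by simp)
    have hshift : ∀ j ∈ Finset.range (n + 1), 0 ≤ (j : ℝ) * h ∧ (j : ℝ) * h ≤ n * h := by
      intro j hj
      have hjn : j ≤ n := Nat.lt_succ_iff.mp (Finset.mem_range.mp hj)
      exact ⟨by positivity, by gcongr⟩
    have hcont : ContinuousOn ((fwdDiff h)^[n] f) (Set.Icc x (x + h)) := by
      have : (fwdDiff h)^[n] f = fun y => ∑ j ∈ Finset.range (n + 1),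
          ((-1 : ℤ) ^ (n - j) * n.choose j) • f (y + j • h) :=
        funext fun y => fwdDiff_iter_eq_sum_shift h f n y
      rw [this]
      refine continuousOn_finsetSum _ fun j hj => ContinuousOn.fun_const_smul ?_ _
      refine hd.continuousOn.comp (by fun_prop) fun y hy => ?_
      obtain ⟨h0, h1⟩ := hshift j hj
      rw [nsmul_eq_mul]
      constructor <;> linarith [hy.1, hy.2]
    have hderiv : ∀ y ∈ Set.Ioo x (x + h), HasDerivAt ((fwdDiff h)^[n] f)
        ((fwdDiff h)^[n] (derivWithin f (Set.Icc a b)) y) y := by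
      intro y hy
      have : (fwdDiff h)^[n] f = fun y => ∑ j ∈ Finset.range (n + 1),
          ((-1 : ℤ) ^ (n - j) * n.choose j) • f (y + j • h) :=
        funext fun y => fwdDiff_iter_eq_sum_shift h f n y
      rw [this, fwdDiff_iter_eq_sum_shift]
      refine HasDerivAt.fun_sum fun j hj => HasDerivAt.fun_const_smul _ ?_
      obtain ⟨h0, h1⟩ := hshift j hj
      refine HasDerivAt.comp_add_const y _ ?_
      have hm : y + j • h ∈ Set.Ioo a b := by
        rw [nsmul_eq_mul]
        constructor <;> linarith [hy.1, hy.2]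
      exact (hd _ (Set.Ioo_subset_Icc_self hm)).hasDerivWithinAt.hasDerivAt
        (Icc_mem_nhds hm.1 hm.2)
    obtain ⟨η, hη, hslope⟩ := exists_hasDerivAt_eq_slope _ _ (by linarith) hcont hderiv
    obtain ⟨ξ, hξ, hval⟩ := ih hf' (x := η) (by linarith [hη.1]) (by linarith [hη.2])
    refine ⟨ξ, ⟨by linarith [hη.1, hξ.1], by push_cast; linarith [hη.2, hξ.2]⟩, ?_⟩
    rw [Function.iterate_succ_apply', fwdDiff, iteratedDerivWithin_succ', pow_succ]
    rw [hval, add_sub_cancel_left, eq_div_iff hh.ne'] at hslope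
    linarith

/-- For `n ≥ 1` and `f ∈ C^n([0,1])`, uniformly over integers `k` with `n < k < N - n`,
`Σ_{l=0}^N φ̂_n(k-l) f(l/N) = (2^n/N^n) f^{(n)}(k/N) + o(N^{-n})` as `N → ∞`. -/
theorem toeplitz_approximates_derivative (n : ℕ) (hn : 0 < n) (f : ℝ → ℝ)
    (hf : ContDiffOn ℝ n f (Set.Icc (0 : ℝ) 1)) :
    ∀ c : ℝ, 0 < c → ∀ᶠ N : ℕ in atTop, ∀ k : ℕ, n < k → k + n < N →
      ‖(∑ l ∈ Finset.range (N + 1),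
            phiHat (n : ℝ) ((k : ℤ) - (l : ℤ)) * ((f ((l : ℝ) / (N : ℝ)) : ℝ) : ℂ)) -
          (((2 : ℝ) ^ n / (N : ℝ) ^ n : ℝ) : ℂ) *
            ((iteratedDerivWithin n f (Set.Icc (0 : ℝ) 1) ((k : ℝ) / (N : ℝ)) : ℝ) : ℂ)‖ ≤
        c * (N : ℝ) ^ (-(n : ℝ)) := by
  intro c hc
  have huc : UniformContinuousOn (iteratedDerivWithin n f (Set.Icc (0 : ℝ) 1)) (Set.Icc 0 1) :=
    isCompact_Icc.uniformContinuousOn_of_continuous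
      (hf.continuousOn_iteratedDerivWithin le_rfl (uniqueDiffOn_Icc zero_lt_one))
  obtain ⟨δ, hδ, hclose⟩ := Metric.uniformContinuousOn_iff.mp huc (c / 2 ^ n) (by positivity)
  have hlim : Tendsto (fun N : ℕ => (n : ℝ) / N) atTop (nhds 0) :=
    tendsto_const_div_atTop_nhds_zero_nat _
  filter_upwards [hlim.eventually_lt_const hδ] with N hN k hnk hkN
  have hN0 : (0 : ℝ) < N := by exact_mod_cast (by omega : 0 < N)
  have hnk' : (n : ℝ) ≤ k := by exact_mod_cast hnk.le
  have hkN' : (k : ℝ) + n ≤ N := by exact_mod_cast hkN.le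
  have hstep : ((k : ℝ) - n) / N + n * (2 / N) = (k + n) / N := by ring
  have hleft : 0 ≤ ((k : ℝ) - n) / N := div_nonneg (by linarith) hN0.le
  have hright : ((k : ℝ) + n) / N ≤ 1 := (div_le_one hN0).mpr hkN'
  obtain ⟨ξ, hξ, hval⟩ := exists_fwdDiff_iter_eq_iteratedDerivWithin (h := 2 / N) zero_lt_one
    (by positivity) n hf hleft (hstep ▸ hright)
  rw [hstep] at hξ
  have hn0 : (0 : ℝ) ≤ n / N := by positivity
  rw [sub_div, add_div] at *
  have hdist := hclose ξ ⟨by linarith [hξ.1], by linarith [hξ.2]⟩ (k / N)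
    ⟨by linarith, by linarith⟩
    (by rw [Real.dist_eq, abs_lt]; constructor <;> linarith [hξ.1, hξ.2])
  rw [Real.dist_eq] at hdist
  rw [sum_phiHat_mul_eq_fwdDiff_iter n N k hnk.le hkN.le f, sub_div, hval, ← div_pow,
    ← Complex.ofReal_mul, ← Complex.ofReal_sub, Complex.norm_real, ← mul_sub, Real.norm_eq_abs,
    abs_mul, abs_of_nonneg (by positivity), Real.rpow_neg hN0.le, Real.rpow_natCast]
  calc (2 / (N : ℝ)) ^ n * _ ≤ (2 / (N : ℝ)) ^ n * (c / 2 ^ n) := by gcongr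
    _ = c * ((N : ℝ) ^ n)⁻¹ := by rw [div_pow]; field_simp
end
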